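/- Let k₀ ∈ ℕ. There exists a constant C > 1 such that for every ℓ ∈ ℕ there is a function φ_ℓ ∈ C^{ℓ+k₀}(ℝ) with the following properties: (i) φ_ℓ(θ) = 1 for |θ| ≤ 1; (ii) φ_ℓ(θ) = 0 for |θ| ≥ 2; (iii) φ_ℓ(θ) ∈ (0, 1) for 1 < |θ| < 2; (iv) max_{1 ≤ j ≤ k₀+1} ‖φ_ℓ^{(j)}‖_{L^∞(ℝ)} ≤ C; (v) ‖φ_ℓ^{(j)}‖_{L^∞(ℝ)} ≤ C (2^{k₀+2} ℓ)^{j-(k₀+1)} for all integers j with k₀+1 < j ≤ ℓ + k₀. -/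

import Mathlib

open Set
open scoped Topology

/-- The average of `f` over the interval `[x - a, x + a]`. -/
noncomputable def movingAverage (a : ℝ) (f : ℝ → ℝ) (x : ℝ) : ℝ :=
  (∫ t in (x - a)..(x + a), f t) / (2 * a)

theorem hasDerivAt_movingAverage (a : ℝ) {f : ℝ → ℝ} (hf : Continuous f) (x : ℝ) :
    HasDerivAt (movingAverage a f) ((f (x + a) - f (x - a)) / (2 * a)) x := by
  have hF (u : ℝ) : HasDerivAt (fun u => ∫ t in (0 : ℝ)..u, f t) (f u) u :=
    (hf.integral_hasStrictDerivAt 0 u).hasDerivAt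
  have heq : movingAverage a f =
      fun x => ((∫ t in (0 : ℝ)..(x + a), f t) - ∫ t in (0 : ℝ)..(x - a), f t) / (2 * a) := by
    funext y
    rw [movingAverage, intervalIntegral.integral_interval_sub_left
      (hf.intervalIntegrable _ _) (hf.intervalIntegrable _ _)]
  rw [heq]
  exact (((hF (x + a)).comp_add_const x a).sub ((hF (x - a)).comp_sub_const x a)).div_const _

theorem deriv_movingAverage (a : ℝ) {f : ℝ → ℝ} (hf : Continuous f) :
    deriv (movingAverage a f) = fun x => (f (x + a) - f (x - a)) / (2 * a) :=
  funext fun x => (hasDerivAt_movingAverage a hf x).deriv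

theorem contDiff_movingAverage (a : ℝ) {f : ℝ → ℝ} {n : ℕ} (hf : ContDiff ℝ n f) :
    ContDiff ℝ (n + 1 : ℕ) (movingAverage a f) := by
  push_cast
  rw [contDiff_succ_iff_deriv]
  refine ⟨fun x => (hasDerivAt_movingAverage a hf.continuous x).differentiableAt, by simp, ?_⟩
  rw [deriv_movingAverage a hf.continuous]
  fun_prop

theorem iteratedDeriv_succ_movingAverage (a : ℝ) {f : ℝ → ℝ} {n : ℕ} (hf : ContDiff ℝ n f)
    (x : ℝ) :
    iteratedDeriv (n + 1) (movingAverage a f) x =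
      (iteratedDeriv n f (x + a) - iteratedDeriv n f (x - a)) / (2 * a) := by
  have h₁ : ContDiff ℝ n fun y => f (y + a) := by fun_prop
  have h₂ : ContDiff ℝ n fun y => f (y - a) := by fun_prop
  rw [iteratedDeriv_succ', deriv_movingAverage a hf.continuous, iteratedDeriv_div_const,
    iteratedDeriv_fun_sub h₁.contDiffAt h₂.contDiffAt, iteratedDeriv_comp_add_const,
    iteratedDeriv_comp_sub_const]

theorem movingAverage_eq_of_eqOn {a c x : ℝ} {f : ℝ → ℝ} (ha : 0 < a)
    (h : ∀ t ∈ Icc (x - a) (x + a), f t = c) : movingAverage a f x = c := by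
  have h_int : ∫ t in (x - a)..(x + a), f t = ∫ _ in (x - a)..(x + a), c :=
    intervalIntegral.integral_congr fun t ht => h t (by rwa [uIcc_of_le (by linarith)] at ht)
  rw [movingAverage, h_int, intervalIntegral.integral_const, smul_eq_mul]
  field_simp
  ring

theorem movingAverage_lt_of_exists_lt {a c x : ℝ} {f : ℝ → ℝ} (ha : 0 < a) (hf : Continuous f)
    (hle : ∀ t, f t ≤ c) (hlt : ∃ t ∈ Icc (x - a) (x + a), f t < c) :
    movingAverage a f x < c := by
  have h_int := intervalIntegral.integral_lt_integral_of_continuousOn_of_le_of_exists_lt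
    (a := x - a) (b := x + a) (f := f) (g := fun _ => c) (by linarith) hf.continuousOn
    continuousOn_const (fun t _ => hle t) hlt
  rw [intervalIntegral.integral_const, smul_eq_mul] at h_int
  rw [movingAverage, div_lt_iff₀ (by linarith)]
  linarith

theorem lt_movingAverage_of_exists_lt {a c x : ℝ} {f : ℝ → ℝ} (ha : 0 < a) (hf : Continuous f)
    (hle : ∀ t, c ≤ f t) (hlt : ∃ t ∈ Icc (x - a) (x + a), c < f t) :
    c < movingAverage a f x := by
  have h_int := intervalIntegral.integral_lt_integral_of_continuousOn_of_le_of_exists_lt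
    (a := x - a) (b := x + a) (f := fun _ => c) (g := f) (by linarith)
    continuousOn_const hf.continuousOn (fun t _ => hle t) hlt
  rw [intervalIntegral.integral_const, smul_eq_mul] at h_int
  rw [movingAverage, lt_div_iff₀ (by linarith)]
  linarith

/-- `f` is a `C^n` cutoff function passing from `1` to `0` exactly on
`3/2 - δ < |x| < 3/2 + δ`, with `j`-th derivative bounded by `B j` for `j ≤ n`. -/
structure IsCutoff (f : ℝ → ℝ) (n : ℕ) (δ : ℝ) (B : ℕ → ℝ) : Prop where
  contDiff : ContDiff ℝ n f
  eq_one : ∀ x, |x| ≤ 3 / 2 - δ → f x = 1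
  eq_zero : ∀ x, 3 / 2 + δ ≤ |x| → f x = 0
  mem_Ioo : ∀ x, 3 / 2 - δ < |x| → |x| < 3 / 2 + δ → f x ∈ Ioo (0 : ℝ) 1
  bound : ∀ j ≤ n, ∀ x, |iteratedDeriv j f x| ≤ B j

namespace IsCutoff

variable {f : ℝ → ℝ} {n : ℕ} {δ : ℝ} {B : ℕ → ℝ}

theorem pos_of_abs_lt (h : IsCutoff f n δ B) {x : ℝ} (hx : |x| < 3 / 2 + δ) : 0 < f x := by
  rcases le_or_gt |x| (3 / 2 - δ) with h' | h'
  · simp [h.eq_one x h']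
  · exact (h.mem_Ioo x h' hx).1

theorem lt_one_of_lt_abs (h : IsCutoff f n δ B) {x : ℝ} (hx : 3 / 2 - δ < |x|) : f x < 1 := by
  rcases le_or_gt (3 / 2 + δ) |x| with h' | h'
  · simp [h.eq_zero x h']
  · exact (h.mem_Ioo x hx h').2

theorem nonneg (h : IsCutoff f n δ B) (x : ℝ) : 0 ≤ f x := by
  rcases le_or_gt (3 / 2 + δ) |x| with h' | h'
  · exact (h.eq_zero x h').ge
  · exact (h.pos_of_abs_lt h').le

theorem le_one (h : IsCutoff f n δ B) (x : ℝ) : f x ≤ 1 := by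
  rcases le_or_gt |x| (3 / 2 - δ) with h' | h'
  · exact (h.eq_one x h').le
  · exact (h.lt_one_of_lt_abs h').le

/-- Averaging a cutoff function over a window of radius `a` gains one derivative, at the price of
a factor `a⁻¹` in the bounds, and widens the transition region by `a`. -/
theorem movingAverage (h : IsCutoff f n δ B) {a : ℝ} (ha : 0 < a) (hδ : 0 < δ)
    (haδ : δ + a ≤ 1 / 2) {B' : ℕ → ℝ} (hB₀ : 1 ≤ B' 0)
    (hB : ∀ j, a⁻¹ * B j ≤ B' (j + 1)) :
    IsCutoff (movingAverage a f) (n + 1) (δ + a) B' := by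
  have hcont := h.contDiff.continuous
  have hone : ∀ x, |x| ≤ 3 / 2 - (δ + a) → _root_.movingAverage a f x = 1 := fun x hx =>
    movingAverage_eq_of_eqOn ha fun t ht => h.eq_one t <| by
      rw [abs_le] at hx ⊢
      constructor <;> linarith [ht.1, ht.2]
  have hzero : ∀ x, 3 / 2 + (δ + a) ≤ |x| → _root_.movingAverage a f x = 0 := fun x hx =>
    movingAverage_eq_of_eqOn ha fun t ht => h.eq_zero t <| by
      rw [le_abs] at hx ⊢
      exact hx.imp (fun hx => by linarith [ht.1]) (fun hx => by linarith [ht.2])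
  have hIoo : ∀ x, 3 / 2 - (δ + a) < |x| → |x| < 3 / 2 + (δ + a) →
      _root_.movingAverage a f x ∈ Ioo (0 : ℝ) 1 := by
    intro x hx₁ hx₂
    rcases le_total 0 x with hx | hx
    · rw [abs_of_nonneg hx] at hx₁ hx₂
      refine ⟨lt_movingAverage_of_exists_lt ha hcont h.nonneg
          ⟨x - a, ⟨le_rfl, by linarith⟩, h.pos_of_abs_lt ?_⟩,
        movingAverage_lt_of_exists_lt ha hcont h.le_one
          ⟨x + a, ⟨by linarith, le_rfl⟩, h.lt_one_of_lt_abs ?_⟩⟩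
      · rw [abs_lt]; constructor <;> linarith
      · rw [lt_abs]; left; linarith
    · rw [abs_of_nonpos hx] at hx₁ hx₂
      refine ⟨lt_movingAverage_of_exists_lt ha hcont h.nonneg
          ⟨x + a, ⟨by linarith, le_rfl⟩, h.pos_of_abs_lt ?_⟩,
        movingAverage_lt_of_exists_lt ha hcont h.le_one
          ⟨x - a, ⟨le_rfl, by linarith⟩, h.lt_one_of_lt_abs ?_⟩⟩
      · rw [abs_lt]; constructor <;> linarith
      · rw [lt_abs]; right; linarith
  refine ⟨contDiff_movingAverage a h.contDiff, hone, hzero, hIoo, ?_⟩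
  rintro (_ | j) hj x
  · refine le_trans ?_ hB₀
    rw [iteratedDeriv_zero]
    rcases le_or_gt |x| (3 / 2 - (δ + a)) with h₁ | h₁
    · simp [hone x h₁]
    rcases le_or_gt (3 / 2 + (δ + a)) |x| with h₂ | h₂
    · simp [hzero x h₂]
    · have := hIoo x h₁ h₂
      rw [abs_of_pos this.1]
      exact this.2.le
  · have hj' : j ≤ n := by omega
    refine le_trans ?_ (hB j)
    rw [iteratedDeriv_succ_movingAverage a (h.contDiff.of_le (by exact_mod_cast hj')), abs_div,
      abs_of_pos (by linarith : 0 < 2 * a), div_le_iff₀ (by linarith)]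
    have h₁ := h.bound j hj' (x + a)
    have h₂ := h.bound j hj' (x - a)
    have h₃ := abs_sub (iteratedDeriv j f (x + a)) (iteratedDeriv j f (x - a))
    have h₄ : a⁻¹ * B j * (2 * a) = 2 * B j := by field_simp
    linarith

end IsCutoff

theorem exists_isCutoff_zero {b : ℝ} (hb : 0 < b) :
    ∃ f, IsCutoff f 0 b fun j => b⁻¹ ^ j := by
  have h2b : 0 < 2 * b := by linarith
  refine ⟨fun x => max 0 (min 1 ((3 / 2 + b - |x|) / (2 * b))), ?_, ?_, ?_, ?_, ?_⟩
  · rw [Nat.cast_zero, contDiff_zero]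
    fun_prop
  · intro x hx
    have : 1 ≤ (3 / 2 + b - |x|) / (2 * b) := by rw [le_div_iff₀ h2b]; linarith
    simp [this]
  · intro x hx
    have : (3 / 2 + b - |x|) / (2 * b) ≤ 0 := div_nonpos_of_nonpos_of_nonneg (by linarith) h2b.le
    simp [this]
  · intro x h₁ h₂
    have hpos : 0 < (3 / 2 + b - |x|) / (2 * b) := div_pos (by linarith) h2b
    have hlt : (3 / 2 + b - |x|) / (2 * b) < 1 := by rw [div_lt_one h2b]; linarith
    simp [hpos, hlt]
  · intro j hj x
    obtain rfl : j = 0 := by omega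
    rw [iteratedDeriv_zero, pow_zero, abs_of_nonneg (le_max_left _ _)]
    exact max_le zero_le_one (min_le_left _ _)

theorem exists_isCutoff {b : ℝ} (hb : 0 < b) (m : ℕ) (hm : (m + 1) * b ≤ 1 / 2) :
    ∃ f, IsCutoff f m ((m + 1) * b) fun j => b⁻¹ ^ j := by
  induction m with
  | zero => simpa using exists_isCutoff_zero hb
  | succ m ih =>
    push_cast at hm
    obtain ⟨f, hf⟩ := ih (by linarith)
    have hstep := hf.movingAverage hb (by positivity) (by linarith)
      (B' := fun j => b⁻¹ ^ j) (by simp) fun j => (pow_succ' b⁻¹ j).ge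
    refine ⟨_, (?_ : ((m : ℝ) + 1) * b + b = _) ▸ hstep⟩
    push_cast
    ring

theorem exists_isCutoff_two_scales {a b : ℝ} (ha : 0 < a) (hb : 0 < b) (m i : ℕ)
    (h : (m + 1) * b + i * a ≤ 1 / 2) :
    ∃ f, IsCutoff f (m + i) ((m + 1) * b + i * a) fun j => a⁻¹ ^ min j i * b⁻¹ ^ (j - i) := by
  induction i with
  | zero => simpa using exists_isCutoff hb m (by simpa using h)
  | succ i ih =>
    push_cast at h
    obtain ⟨f, hf⟩ := ih (by linarith)
    have hstep := hf.movingAverage ha (by positivity) (by linarith)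
      (B' := fun j => a⁻¹ ^ min j (i + 1) * b⁻¹ ^ (j - (i + 1))) (by simp) fun j => by
        rw [Nat.add_min_add_right, Nat.add_sub_add_right, pow_succ', mul_assoc]
    refine ⟨_, (?_ : ((m : ℝ) + 1) * b + i * a + a = _) ▸ hstep⟩
    push_cast
    ring

/-- For every `k₀ ∈ ℕ` there is a constant `C > 1` such that for each `ℓ ≥ 1`
there is a function `φ_ℓ ∈ C^{ℓ+k₀}(ℝ)` with `φ_ℓ = 1` on `|θ| ≤ 1`, `φ_ℓ = 0` on `|θ| ≥ 2`,
`φ_ℓ(θ) ∈ (0,1)` for `1 < |θ| < 2`, whose derivatives of order `1 ≤ j ≤ k₀+1` are bounded by `C`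
and whose derivatives of order `k₀+1 < j ≤ ℓ+k₀` are bounded by `C (2^{k₀+2} ℓ)^{j-(k₀+1)}`. -/
theorem stmt3 (k₀ : ℕ) :
    ∃ C : ℝ, 1 < C ∧ ∀ ℓ : ℕ, 1 ≤ ℓ → ∃ φ : ℝ → ℝ,
      ContDiff ℝ (ℓ + k₀ : ℕ) φ ∧
      (∀ θ : ℝ, |θ| ≤ 1 → φ θ = 1) ∧
      (∀ θ : ℝ, 2 ≤ |θ| → φ θ = 0) ∧
      (∀ θ : ℝ, 1 < |θ| → |θ| < 2 → φ θ ∈ Ioo (0 : ℝ) 1) ∧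
      (∀ j : ℕ, 1 ≤ j → j ≤ k₀ + 1 → ∀ θ : ℝ, |iteratedDeriv j φ θ| ≤ C) ∧
      (∀ j : ℕ, k₀ + 1 < j → j ≤ ℓ + k₀ → ∀ θ : ℝ,
        |iteratedDeriv j φ θ| ≤ C * ((2 ^ (k₀ + 2) * ℓ : ℕ) : ℝ) ^ (j - (k₀ + 1))) := by
  have hα : (1 : ℝ) < 4 * (k₀ + 1) := by
    have : (0 : ℝ) ≤ k₀ := k₀.cast_nonneg
    linarith
  have hC : (1 : ℝ) < (4 * (k₀ + 1)) ^ (k₀ + 1) := one_lt_pow₀ hα (by omega)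
  refine ⟨(4 * (k₀ + 1)) ^ (k₀ + 1), hC, fun ℓ hℓ => ?_⟩
  obtain ⟨m, rfl⟩ : ∃ m, ℓ = m + 1 := ⟨ℓ - 1, by omega⟩
  have hδ : ((m : ℝ) + 1) * (4 * ((m : ℝ) + 1))⁻¹ +
      ((k₀ + 1 : ℕ) : ℝ) * (4 * ((k₀ : ℝ) + 1))⁻¹ = 1 / 2 := by
    push_cast
    field_simp
    norm_num
  obtain ⟨f, hf⟩ := exists_isCutoff_two_scales (a := (4 * ((k₀ : ℝ) + 1))⁻¹)
    (b := (4 * ((m : ℝ) + 1))⁻¹) (by positivity) (by positivity) m (k₀ + 1) hδ.le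
  rw [hδ] at hf
  simp only [inv_inv] at hf
  refine ⟨f, ?_, fun θ hθ => hf.eq_one θ (by linarith), fun θ hθ => hf.eq_zero θ (by linarith),
    fun θ h₁ h₂ => hf.mem_Ioo θ (by linarith) (by linarith), fun j _ hj θ => ?_,
    fun j hj hjm θ => ?_⟩
  · rw [show m + 1 + k₀ = m + (k₀ + 1) by ring]
    exact hf.contDiff
  · refine (hf.bound j (by omega) θ).trans ?_
    rw [min_eq_left hj, Nat.sub_eq_zero_of_le hj, pow_zero, mul_one]
    exact pow_le_pow_right₀ hα.le hj
  · refine (hf.bound j (by omega) θ).trans ?_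
    rw [min_eq_right hj.le]
    have h4 : (4 : ℝ) ≤ 2 ^ (k₀ + 2) := by
      rw [pow_add]
      linarith [one_le_pow₀ (one_le_two : (1 : ℝ) ≤ 2) (n := k₀)]
    push_cast
    gcongr
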